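/- Let R be a commutative Noetherian ring and K a bounded cochain complex of finitely generated projective R-modules. Assume that for every maximal ideal 𝔪 ⊆ R and every integer i < 0, the i-th cohomology of the complex K ⊗_R R/𝔪 (termwise tensor product) vanishes. Then there exist a bounded cochain complex L of finitely generated projective R-modules with Lⁱ = 0 for all i < 0 and a homotopy equivalence between K and L; consequently, Hⁱ(K ⊗_R M) = 0 for every R-module M and every i < 0. -/

import Mathlib

open CategoryTheory CategoryTheory.Limits

namespace NakayamaNL

variable {R : Type} [CommRing R]

/-- The termwise tensor product `K ⊗_R M` of a cochain complex with a module. -/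
noncomputable def tensComplex (K : CochainComplex (ModuleCat R) ℤ) (M : ModuleCat R) :
    CochainComplex (ModuleCat R) ℤ :=
  ((MonoidalCategory.tensorRight M).mapHomologicalComplex (ComplexShape.up ℤ)).obj K

end NakayamaNL

/-- Over a division ring, a linear map whose kernel contains that of `f` factors through `f`. -/
theorem LinearMap.exists_comp_eq_of_ker_le {k V W U : Type*} [DivisionRing k]
    [AddCommGroup V] [Module k V] [AddCommGroup W] [Module k W] [AddCommGroup U] [Module k U]
    (f : V →ₗ[k] W) (g : V →ₗ[k] U) (h : LinearMap.ker f ≤ LinearMap.ker g) :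
    ∃ t : W →ₗ[k] U, t ∘ₗ f = g := by
  obtain ⟨r, hr⟩ := LinearMap.exists_leftInverse_of_injective
    ((LinearMap.ker f).liftQ f le_rfl) (Submodule.ker_liftQ_eq_bot _ _ _ le_rfl)
  refine ⟨(LinearMap.ker f).liftQ g h ∘ₗ r, ?_⟩
  ext x
  have hx := LinearMap.congr_fun hr (Submodule.Quotient.mk x)
  simp only [LinearMap.comp_apply, Submodule.liftQ_apply, LinearMap.id_apply] at hx
  simp [hx]

section

variable {R : Type*} [CommRing R]

/-- A linear map from a finite projective module `P` to `I • N` is an `I`-linear combination of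
linear maps from `P` to `N`. -/
theorem Module.Projective.mem_smul_top_of_forall_mem_smul_top {P N : Type*} [AddCommGroup P]
    [Module R P] [AddCommGroup N] [Module R N] [Module.Finite R P] [Module.Projective R P]
    (I : Ideal R) (h : P →ₗ[R] N) (hh : ∀ x, h x ∈ (I • ⊤ : Submodule R N)) :
    h ∈ (I • ⊤ : Submodule R (P →ₗ[R] N)) := by
  obtain ⟨n, f, g, -, -, hfg⟩ := Module.Finite.exists_comp_eq_id_of_projective R P
  have key : h = ∑ j, (LinearMap.proj j ∘ₗ g).smulRight (h (f (Pi.single j 1))) := by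
    ext x
    have hx : f (g x) = x := LinearMap.congr_fun hfg x
    conv_lhs => rw [← hx, ← (Pi.basisFun R (Fin n)).sum_repr (g x)]
    simp
  rw [key]
  refine Submodule.sum_mem _ fun j _ ↦ ?_
  have : (I • ⊤ : Submodule R N) ≤
      (I • ⊤ : Submodule R (P →ₗ[R] N)).comap (LinearMap.smulRightₗ (LinearMap.proj j ∘ₗ g)) := by
    refine Submodule.smul_le.2 fun r hr y _ ↦ ?_
    rw [Submodule.mem_comap, map_smul]
    exact Submodule.smul_mem_smul hr trivial
  exact this (hh _)

/-- A linear map that vanishes modulo `𝔪` on the kernel modulo `𝔪` of a linear map `g` to a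
projective module factors through `g` modulo `𝔪`. -/
theorem Module.Projective.exists_sub_comp_mem_smul_top {B C D : Type*}
    [AddCommGroup B] [Module R B] [AddCommGroup C] [Module R C] [AddCommGroup D] [Module R D]
    [Module.Projective R C] (𝔪 : Ideal R) [𝔪.IsMaximal] (g : B →ₗ[R] C) (e : B →ₗ[R] D)
    (h : ∀ x, g x ∈ (𝔪 • ⊤ : Submodule R C) → e x ∈ (𝔪 • ⊤ : Submodule R D)) :
    ∃ s : C →ₗ[R] D, ∀ x, e x - s (g x) ∈ (𝔪 • ⊤ : Submodule R D) := by
  let _ := Ideal.Quotient.field 𝔪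
  have hsurj : Function.Surjective (algebraMap R (R ⧸ 𝔪)) := Ideal.Quotient.mk_surjective
  let g' := (Submodule.mapQ _ _ g (Submodule.smul_top_le_comap_smul_top 𝔪 g)).extendScalarsOfSurjective
    hsurj
  let e' := (Submodule.mapQ _ _ e (Submodule.smul_top_le_comap_smul_top 𝔪 e)).extendScalarsOfSurjective
    hsurj
  obtain ⟨t, ht⟩ := LinearMap.exists_comp_eq_of_ker_le g' e' <| by
    intro y hy
    obtain ⟨x, rfl⟩ := Submodule.Quotient.mk_surjective _ y
    exact (Submodule.Quotient.mk_eq_zero _).2 (h x ((Submodule.Quotient.mk_eq_zero _).1 hy))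
  obtain ⟨s, hs⟩ := Module.projective_lifting_property (𝔪 • ⊤ : Submodule R D).mkQ
    (t.restrictScalars R ∘ₗ (𝔪 • ⊤ : Submodule R C).mkQ) (Submodule.mkQ_surjective _)
  refine ⟨s, fun x ↦ (Submodule.Quotient.eq _).1 ?_⟩
  exact (LinearMap.congr_fun ht (Submodule.Quotient.mk x)).symm.trans
    (LinearMap.congr_fun hs (g x)).symm

/-- Let `e` be an idempotent endomorphism of a finite projective module. If, modulo every maximal
ideal, `e` vanishes on the kernel of `g`, and `g ∘ e = g`, then `e` factors through `g`. -/
theorem Module.Projective.exists_comp_eq_of_isIdempotentElem [IsNoetherianRing R] {B C : Type*}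
    [AddCommGroup B] [Module R B] [AddCommGroup C] [Module R C]
    [Module.Finite R B] [Module.Projective R B] [Module.Projective R C]
    (g : B →ₗ[R] C) (e : B →ₗ[R] B) (he : e ∘ₗ e = e) (hg : g ∘ₗ e = g)
    (h : ∀ 𝔪 : Ideal R, 𝔪.IsMaximal → ∀ x, g x ∈ (𝔪 • ⊤ : Submodule R C) →
      e x ∈ (𝔪 • ⊤ : Submodule R B)) :
    ∃ t : C →ₗ[R] B, t ∘ₗ g = e := by
  let N : Submodule R (B →ₗ[R] B) := LinearMap.range (LinearMap.lcomp R B g)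
  let Q : Submodule R (B →ₗ[R] B) := LinearMap.range (LinearMap.lcomp R B e)
  suffices hN : (1 : R) ∈ N.colon (Q : Set (B →ₗ[R] B)) by
    rw [Submodule.mem_colon] at hN
    obtain ⟨t, ht⟩ := hN e ⟨LinearMap.id, by ext; simp⟩
    exact ⟨t, by rwa [one_smul] at ht⟩
  rw [← Ideal.eq_top_iff_one]
  by_contra hne
  obtain ⟨𝔪, hm, hle⟩ := Ideal.exists_le_maximal _ hne
  obtain ⟨s, hs⟩ := exists_sub_comp_mem_smul_top 𝔪 g e (h 𝔪 hm)
  have hQ : Q ≤ N ⊔ 𝔪 • Q := by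
    rintro _ ⟨φ, rfl⟩
    have hφ : φ ∘ₗ (e - s ∘ₗ g) ∈ (𝔪 • ⊤ : Submodule R (B →ₗ[R] B)) :=
      mem_smul_top_of_forall_mem_smul_top 𝔪 _ fun x ↦
        Submodule.smul_top_le_comap_smul_top 𝔪 φ (hs x)
    have hφe : (φ ∘ₗ (e - s ∘ₗ g)) ∘ₗ e ∈ 𝔪 • Q := by
      have := Submodule.mem_map_of_mem (f := LinearMap.lcomp R B e) hφ
      rwa [Submodule.map_smul'', Submodule.map_top] at this
    refine Submodule.mem_sup.2 ⟨φ ∘ₗ s ∘ₗ g, ⟨φ ∘ₗ s, rfl⟩, _, hφe, ?_⟩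
    ext x
    have h1 := LinearMap.congr_fun he x
    have h2 := LinearMap.congr_fun hg x
    simp only [LinearMap.comp_apply] at h1 h2
    simp [h1, h2]
  obtain ⟨r, hr, hrN⟩ := Submodule.exists_sub_one_mem_and_smul_le_of_fg_of_le_sup
    (Module.Finite.iff_fg.1 inferInstance : Q.FG) le_rfl hQ
  have hrm : r ∈ 𝔪 := hle <| Submodule.mem_colon.2 fun q hq ↦
    hrN (Submodule.smul_mem_pointwise_smul q r Q hq)
  exact hm.ne_top ((Ideal.eq_top_iff_one _).2 (by simpa using 𝔪.sub_mem hrm hr))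

/-- Let `A → B → C` be exact modulo every maximal ideal, with `B` finite projective and `C`
projective. A partial contraction `s : B → A` extends to `C`. -/
theorem Module.Projective.exists_contraction_of_exact_mod_maximal [IsNoetherianRing R]
    {A B C : Type*} [AddCommGroup A] [Module R A]
    [AddCommGroup B] [Module R B] [AddCommGroup C] [Module R C]
    [Module.Finite R B] [Module.Projective R B] [Module.Projective R C]
    (f : A →ₗ[R] B) (g : B →ₗ[R] C) (s : B →ₗ[R] A) (hgf : g ∘ₗ f = 0) (hs : f ∘ₗ s ∘ₗ f = f)
    (h : ∀ 𝔪 : Ideal R, 𝔪.IsMaximal → ∀ x, g x ∈ (𝔪 • ⊤ : Submodule R C) →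
      ∃ a, x - f a ∈ (𝔪 • ⊤ : Submodule R B)) :
    ∃ t : C →ₗ[R] B, t ∘ₗ g + f ∘ₗ s = LinearMap.id := by
  have hs' (a) : f (s (f a)) = f a := LinearMap.congr_fun hs a
  have hgf' (a) : g (f a) = 0 := LinearMap.congr_fun hgf a
  obtain ⟨t, ht⟩ := exists_comp_eq_of_isIdempotentElem g (LinearMap.id - f ∘ₗ s)
    (by ext; simp [hs']) (by ext; simp [hgf']) fun 𝔪 hm x hx ↦ by
      obtain ⟨a, ha⟩ := h 𝔪 hm x hx
      have := Submodule.smul_top_le_comap_smul_top 𝔪 (LinearMap.id - f ∘ₗ s) ha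
      simpa [hs'] using this
  exact ⟨t, by rw [ht, sub_add_cancel]⟩

theorem Ideal.tmul_one_eq_zero_iff {M : Type*} [AddCommGroup M] [Module R M] (I : Ideal R) (x : M) :
    x ⊗ₜ[R] (1 : R ⧸ I) = 0 ↔ x ∈ (I • ⊤ : Submodule R M) := by
  rw [← TensorProduct.tensorQuotEquivQuotSMul_symm_mk, LinearEquiv.map_eq_zero_iff,
    Submodule.Quotient.mk_eq_zero]

theorem Ideal.exists_tmul_one_eq {M : Type*} [AddCommGroup M] [Module R M] (I : Ideal R)
    (z : TensorProduct R M (R ⧸ I)) : ∃ x : M, x ⊗ₜ[R] (1 : R ⧸ I) = z := by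
  obtain ⟨x, hx⟩ := Submodule.Quotient.mk_surjective _ (TensorProduct.tensorQuotEquivQuotSMul M I z)
  exact ⟨x, by rw [← TensorProduct.tensorQuotEquivQuotSMul_symm_mk, hx, LinearEquiv.symm_apply_apply]⟩

end

/-- A complex whose negative part is contracted by `s` is homotopy equivalent to a degreewise
retract that vanishes in negative degrees. -/
theorem CochainComplex.exists_homotopyEquiv_of_contraction {C : Type*} [Category C] [Abelian C]
    (K : CochainComplex C ℤ) (s : ∀ i j, K.X i ⟶ K.X j)
    (hs : ∀ i j k : ℤ, i + 1 = j → j + 1 = k → j < 0 →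
      K.d j k ≫ s k j + s j i ≫ K.d i j = 𝟙 _) :
    ∃ L : CochainComplex C ℤ, (∀ i < 0, IsZero (L.X i)) ∧
      (∀ i, Nonempty (Retract (L.X i) (K.X i))) ∧ Nonempty (HomotopyEquiv K L) := by
  let h (i j : ℤ) : K.X i ⟶ K.X j := if j + 1 = i ∧ i ≤ 0 then s i j else 0
  let p : K ⟶ K := 𝟙 K - Homotopy.nullHomotopicMap h
  have hp (j : ℤ) : p.f j = 𝟙 _ - (K.d j (j + 1) ≫ h (j + 1) j + h j (j - 1) ≫ K.d (j - 1) j) := by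
    rw [← Homotopy.nullHomotopicMap_f (c := ComplexShape.up ℤ) (by simp) (by simp) h]
    rfl
  have hneg (j : ℤ) (hj : j < 0) : p.f j = 0 := by
    rw [hp, sub_eq_zero, ← hs (j - 1) j (j + 1) (by lia) rfl hj]
    simp only [h]
    rw [if_pos (by lia), if_pos (by lia)]
  have hidem : p ≫ p = p := by
    ext j
    rw [HomologicalComplex.comp_f]
    rcases lt_trichotomy j 0 with hj | rfl | hj
    · simp [hneg j hj]
    · have h0 := hs (-2) (-1) 0 (by lia) (by lia) (by lia)
      have h1 : p.f 0 = 𝟙 _ - s 0 (-1) ≫ K.d (-1) 0 := by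
        rw [hp]; simp [h]
      have h2 : K.d (-1) 0 ≫ s 0 (-1) ≫ K.d (-1) 0 = K.d (-1) 0 := by
        have := congrArg (· ≫ K.d (-1) 0) h0
        simpa using this
      simp [h1, h2]
    · have h1 : p.f j = 𝟙 _ := by
        rw [hp]; simp only [h]
        rw [if_neg (by lia), if_neg (by lia)]; simp
      simp [h1]
  obtain ⟨L, ι, π, hιπ, hπι⟩ := IsIdempotentComplete.idempotents_split K p hidem
  let r : Retract L K := ⟨ι, π, hιπ⟩
  refine ⟨L, fun i hi ↦ ?_, fun i ↦ ⟨r.map (HomologicalComplex.eval C _ i)⟩, ⟨⟨π, ι, ?_, ?_⟩⟩⟩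
  · rw [IsZero.iff_id_eq_zero]
    have h1 : 𝟙 L = ι ≫ p ≫ π := by simp [← hπι, hιπ]
    have h2 := HomologicalComplex.congr_hom h1 i
    simpa [hneg i hi] using h2
  · refine (Homotopy.ofEq hπι).trans (Homotopy.equivSubZero.symm ?_).symm
    exact (Homotopy.ofEq (by simp [p])).trans
      (Homotopy.nullHomotopy h fun i j hij ↦ if_neg fun h ↦ hij h.1)
  · exact Homotopy.ofEq hιπ

/-- A contraction of the negative part of a bounded below complex can be constructed one degree
at a time. -/
theorem CochainComplex.exists_contraction {C : Type*} [Category C] [Preadditive C]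
    (K : CochainComplex C ℤ) (a : ℤ) (ha : ∀ i < a, IsZero (K.X i))
    (hstep : ∀ i j k : ℤ, i + 1 = j → j + 1 = k → j < 0 → ∀ s : K.X j ⟶ K.X i,
      K.d i j ≫ s ≫ K.d i j = K.d i j → ∃ t : K.X k ⟶ K.X j, K.d j k ≫ t + s ≫ K.d i j = 𝟙 _) :
    ∃ s : ∀ i j, K.X i ⟶ K.X j, ∀ i j k : ℤ, i + 1 = j → j + 1 = k → j < 0 →
      K.d j k ≫ s k j + s j i ≫ K.d i j = 𝟙 _ := by
  suffices ∀ n : ℤ, min a 0 ≤ n → n ≤ 0 → ∃ s : ∀ i j, K.X i ⟶ K.X j,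
      ∀ i j k : ℤ, i + 1 = j → j + 1 = k → j < n →
        K.d j k ≫ s k j + s j i ≫ K.d i j = 𝟙 _ from this 0 (min_le_right _ _) le_rfl
  intro n hn
  induction n, hn using Int.leInduction with
  | base => exact fun _ ↦ ⟨fun _ _ ↦ 0, fun i j k _ _ hj ↦ (ha j (by lia)).eq_of_src _ _⟩
  | succ n _ ih =>
    intro hn
    obtain ⟨s, hs⟩ := ih (by lia)
    obtain ⟨t, ht⟩ := hstep (n - 1) n (n + 1) (by lia) rfl (by lia) (s n (n - 1)) <| by
      have := congrArg (· ≫ K.d (n - 1) n) (hs (n - 2) (n - 1) n (by lia) (by lia) (by lia))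
      simpa using this
    refine ⟨fun i j ↦ if h : i = n + 1 ∧ j = n then
      eqToHom (by rw [h.1]) ≫ t ≫ eqToHom (by rw [h.2]) else s i j, fun i j k hij hjk hj ↦ ?_⟩
    beta_reduce
    rw [dif_neg (by lia : ¬ (j = n + 1 ∧ i = n))]
    rcases (show j < n ∨ j = n by lia) with h | rfl
    · rw [dif_neg (by lia)]
      exact hs _ _ _ hij hjk h
    · obtain rfl : i = j - 1 := by lia
      subst hjk
      simpa using ht

namespace NakayamaNL

variable {R : Type} [CommRing R]

theorem isZero_tensComplex_homology_of_homotopyEquiv {K L : CochainComplex (ModuleCat R) ℤ}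
    (e : HomotopyEquiv K L) (M : ModuleCat R) {i : ℤ} (hL : IsZero (L.X i)) :
    IsZero ((tensComplex K M).homology i) := by
  refine IsZero.of_iso ?_
    (((MonoidalCategory.tensorRight M).mapHomotopyEquiv e).toHomologyIso i)
  exact ShortComplex.isZero_homology_of_isZero_X₂ _
    (Functor.map_isZero (MonoidalCategory.tensorRight M) hL)

theorem exists_sub_mem_smul_top_of_isZero_homology (K : CochainComplex (ModuleCat R) ℤ)
    (I : Ideal R) {i j k : ℤ} (hij : i + 1 = j) (hjk : j + 1 = k)
    (h : IsZero ((tensComplex K (ModuleCat.of R (R ⧸ I))).homology j)) (x : K.X j)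
    (hx : K.d j k x ∈ (I • ⊤ : Submodule R (K.X k))) :
    ∃ a, x - K.d i j a ∈ (I • ⊤ : Submodule R (K.X j)) := by
  rw [← HomologicalComplex.exactAt_iff_isZero_homology,
    HomologicalComplex.exactAt_iff' _ i j k (by simp; lia) (by simp; lia),
    ShortComplex.moduleCat_exact_iff] at h
  obtain ⟨z, hz⟩ := h (x ⊗ₜ[R] (1 : R ⧸ I)) ((I.tmul_one_eq_zero_iff _).2 hx)
  obtain ⟨a, rfl⟩ := I.exists_tmul_one_eq z
  refine ⟨a, (I.tmul_one_eq_zero_iff _).1 ?_⟩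
  rw [TensorProduct.sub_tmul, sub_eq_zero]
  exact hz.symm

/-- If `K` is a bounded complex of finitely generated projective modules over a Noetherian
commutative ring `R` such that `Hⁱ(K ⊗ R/𝔪) = 0` for all maximal ideals `𝔪` and all `i < 0`,
then `K` is homotopy equivalent to a bounded complex of finitely generated projectives
concentrated in non-negative degrees; consequently `Hⁱ(K ⊗ M) = 0` for all modules `M` and
all `i < 0`. -/
theorem statement4 [IsNoetherianRing R] (K : CochainComplex (ModuleCat R) ℤ)
    (hbdd : ∃ a b : ℤ, ∀ i : ℤ, (i < a ∨ b < i) → IsZero (K.X i))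
    (hfin : ∀ i : ℤ, Module.Finite R (K.X i))
    (hproj : ∀ i : ℤ, Module.Projective R (K.X i))
    (hvanish : ∀ (𝔪 : Ideal R), 𝔪.IsMaximal → ∀ i : ℤ, i < 0 →
      IsZero ((tensComplex K (ModuleCat.of R (R ⧸ 𝔪))).homology i)) :
    (∃ L : CochainComplex (ModuleCat R) ℤ,
      (∃ b : ℤ, ∀ i : ℤ, b < i → IsZero (L.X i)) ∧
      (∀ i : ℤ, i < 0 → IsZero (L.X i)) ∧
      (∀ i : ℤ, Module.Finite R (L.X i)) ∧
      (∀ i : ℤ, Module.Projective R (L.X i)) ∧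
      Nonempty (HomotopyEquiv K L)) ∧
    (∀ M : ModuleCat R, ∀ i : ℤ, i < 0 → IsZero ((tensComplex K M).homology i)) := by
  obtain ⟨a, b, hab⟩ := hbdd
  obtain ⟨s, hs⟩ := K.exists_contraction a (fun i hi ↦ hab i (.inl hi)) <| by
    intro i j k hij hjk hj s hs
    obtain ⟨t, ht⟩ := Module.Projective.exists_contraction_of_exact_mod_maximal
      (K.d i j).hom (K.d j k).hom s.hom (by rw [← ModuleCat.hom_comp, K.d_comp_d]; rfl)
      (congrArg ModuleCat.Hom.hom hs) fun 𝔪 hm x hx ↦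
        exists_sub_mem_smul_top_of_isZero_homology K 𝔪 hij hjk (hvanish 𝔪 hm j hj) x hx
    exact ⟨ModuleCat.ofHom t, ModuleCat.hom_ext ht⟩
  obtain ⟨L, hL, hret, ⟨e⟩⟩ := K.exists_homotopyEquiv_of_contraction s hs
  refine ⟨⟨L, ⟨b, fun i hi ↦ ?_⟩, hL, fun i ↦ ?_, fun i ↦ ?_, ⟨e⟩⟩,
    fun M i hi ↦ isZero_tensComplex_homology_of_homotopyEquiv e M (hL i hi)⟩
  all_goals obtain ⟨r⟩ := hret i
  · exact (hab i (.inr hi)).of_mono r.i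
  · exact Module.Finite.of_surjective r.r.hom ((ModuleCat.epi_iff_surjective _).1 inferInstance)
  · exact Module.Projective.of_split r.i.hom r.r.hom (congrArg ModuleCat.Hom.hom r.retract)

end NakayamaNL
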